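/- For a polynomial f ∈ k[x_1,...,x_m,y_1,...,y_n] symmetric separately in the x's and y's, condition (a) the substitution x_1 = T, y_1 = -T yields a polynomial independent of T, is equivalent to condition (b) (∂f/∂x_1 - ∂f/∂y_1) is divisible by (x_1 + y_1) in the polynomial ring. -/

import Mathlib

open MvPolynomial

/-- The substitution `x₁ = T, y₁ = -T` (other variables untouched), landing in
polynomials in `T` over the polynomial ring. -/
noncomputable def subst (k : Type*) [Field k] (m n : ℕ) :
    MvPolynomial (Fin (m + 1) ⊕ Fin (n + 1)) k →ₐ[k]
      Polynomial (MvPolynomial (Fin (m + 1) ⊕ Fin (n + 1)) k) :=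
  aeval (fun v => if v = Sum.inl 0 then Polynomial.X
    else if v = Sum.inr 0 then -Polynomial.X
    else Polynomial.C (X v))

/-- Symmetric in the `x`-variables. -/
def SymX (k : Type*) [Field k] (m n : ℕ)
    (f : MvPolynomial (Fin (m + 1) ⊕ Fin (n + 1)) k) : Prop :=
  ∀ σ : Equiv.Perm (Fin (m + 1)), rename (Sum.map σ id) f = f

/-- Symmetric in the `y`-variables. -/
def SymY (k : Type*) [Field k] (m n : ℕ)
    (f : MvPolynomial (Fin (m + 1) ⊕ Fin (n + 1)) k) : Prop :=
  ∀ τ : Equiv.Perm (Fin (n + 1)), rename (Sum.map id τ) f = f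

/-- Supersymmetric polynomial. -/
def SuperSym (k : Type*) [Field k] (m n : ℕ)
    (f : MvPolynomial (Fin (m + 1) ⊕ Fin (n + 1)) k) : Prop :=
  SymX k m n f ∧ SymY k m n f ∧ ∃ c, subst k m n f = Polynomial.C c

theorem subst_derivative (k : Type*) [Field k] (m n : ℕ)
    (f : MvPolynomial (Fin (m + 1) ⊕ Fin (n + 1)) k) :
    Polynomial.derivative (subst k m n f) =
      subst k m n (pderiv (Sum.inl 0) f - pderiv (Sum.inr 0) f) := by
  induction f using MvPolynomial.induction_on with
  | C a =>
    have h : subst k m n (C a) = Polynomial.C (C a) := by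
      simp [subst]
    rw [h]
    simp
  | add p q hp hq =>
    simp only [map_add, map_sub] at *
    rw [hp, hq]
    ring
  | mul_X p v hp =>
    have hX : Polynomial.derivative (subst k m n (X v)) =
        subst k m n (pderiv (Sum.inl 0) (X v) - pderiv (Sum.inr 0) (X v)) := by
      by_cases h1 : v = Sum.inl 0
      · subst h1
        simp [subst, pderiv_X]
      · by_cases h2 : v = Sum.inr 0
        · subst h2
          simp [subst, pderiv_X]
        · simp [subst, pderiv_X, h1, h2, Pi.single_apply]
    simp only [map_mul, map_sub, Polynomial.derivative_mul, Derivation.leibniz, smul_eq_mul,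
      map_add] at *
    rw [hp, hX]
    ring

theorem subst_sub_dvd (k : Type*) [Field k] (m n : ℕ)
    (g : MvPolynomial (Fin (m + 1) ⊕ Fin (n + 1)) k) :
    (X (Sum.inl 0) + X (Sum.inr 0)) ∣
      (g - Polynomial.eval (X (Sum.inl 0)) (subst k m n g)) := by
  induction g using MvPolynomial.induction_on with
  | C a =>
    have h : subst k m n (C a) = Polynomial.C (C a) := by
      simp [subst]
    rw [h]
    simp
  | add p q hp hq =>
    have := dvd_add hp hq
    rw [map_add, Polynomial.eval_add]
    convert this using 1
    ring
  | mul_X p v hp =>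
    have hX : ((X (Sum.inl 0) + X (Sum.inr 0)) : MvPolynomial (Fin (m + 1) ⊕ Fin (n + 1)) k) ∣
        X v - Polynomial.eval (X (Sum.inl 0)) (subst k m n (X v)) := by
      by_cases h1 : v = Sum.inl 0
      · subst h1
        simp [subst]
      · by_cases h2 : v = Sum.inr 0
        · subst h2
          simp [subst, add_comm]
        · simp [subst, h1, h2]
    rw [map_mul, Polynomial.eval_mul]
    exact dvd_mul_sub_mul hp hX

theorem subst_eq_zero_iff (k : Type*) [Field k] (m n : ℕ)
    (g : MvPolynomial (Fin (m + 1) ⊕ Fin (n + 1)) k) :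
    subst k m n g = 0 ↔ (X (Sum.inl 0) + X (Sum.inr 0)) ∣ g := by
  constructor
  · intro h
    simpa [h] using subst_sub_dvd k m n g
  · rintro ⟨q, rfl⟩
    rw [map_mul]
    have : subst k m n (X (Sum.inl 0) + X (Sum.inr 0)) = 0 := by simp [subst]
    rw [this, zero_mul]

/-- For `f` symmetric in the `x`'s and in the `y`'s, the substitution
`x₁ = T, y₁ = -T` yields a polynomial independent of `T` iff
`∂f/∂x₁ - ∂f/∂y₁` is divisible by `x₁ + y₁`. -/
theorem supersym_subst_iff_pderiv_div (k : Type*) [Field k] [CharZero k] (m n : ℕ)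
    (f : MvPolynomial (Fin (m + 1) ⊕ Fin (n + 1)) k)
    (hx : SymX k m n f) (hy : SymY k m n f) :
    (∃ c, subst k m n f = Polynomial.C c) ↔
      (X (Sum.inl 0) + X (Sum.inr 0)) ∣
        (pderiv (Sum.inl 0) f - pderiv (Sum.inr 0) f) := by
  rw [← subst_eq_zero_iff, ← subst_derivative]
  constructor
  · rintro ⟨c, hc⟩
    rw [hc, Polynomial.derivative_C]
  · intro h
    exact ⟨_, Polynomial.eq_C_of_natDegree_eq_zero
      (Polynomial.derivative_eq_zero.1 h)⟩
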